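/- For all m ≥ 1 and all k ∈ ℤ∖{0}, the following relation holds in H_{1,m+1}(q): there exist finitely many coefficients f_i, g_i ∈ R, elements w_i, u_i ∈ H_{m+1}(q), and integer tuples (λ_0^{(i)}, λ_1^{(i)}, …, λ_m^{(i)}) with Σ_{j=0}^{m} λ_j^{(i)} = k and with all λ_j^{(i)} ≥ 0 if k > 0 (respectively all λ_j^{(i)} ≤ 0 if k < 0), such that (t′_m)^k = q^{−mk} · t_m^k + Σ_i f_i · t_m^k · w_i + Σ_i g_i · t^{λ_0^{(i)}} t_1^{λ_1^{(i)}} ⋯ t_m^{λ_m^{(i)}} · u_i. -/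

import Mathlib

set_option synthInstance.maxHeartbeats 1000000
set_option maxHeartbeats 2000000

namespace MB

/-! ## The mixed braid group `B_{1,n}` (with `m = n - 1` braiding generators) -/

/-- Generators: `none` is the looping generator `t`, `some i` is `σ_{i+1}` for `i : Fin m`. -/
abbrev MBGen (m : ℕ) := Option (Fin m)

/-- The relators of the mixed braid group `B_{1,n}` (`m = n-1`):
`σ₁tσ₁t = tσ₁tσ₁`; `tσ_i = σ_i t` for `i > 1`; the braid relations among the `σ_i`. -/
def rels (m : ℕ) : Set (FreeGroup (MBGen m)) :=
  { r | (∃ h : 0 < m,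
          r = (FreeGroup.of (some ⟨0, h⟩) * FreeGroup.of none) ^ 2 *
              ((FreeGroup.of (none : MBGen m) * FreeGroup.of (some ⟨0, h⟩)) ^ 2)⁻¹) ∨
        (∃ i : Fin m, 1 ≤ (i : ℕ) ∧
          r = FreeGroup.of (none : MBGen m) * FreeGroup.of (some i) *
              (FreeGroup.of (some i) * FreeGroup.of (none : MBGen m))⁻¹) ∨
        (∃ i j : Fin m, (i : ℕ) + 1 = (j : ℕ) ∧
          r = FreeGroup.of (some i) * FreeGroup.of (some j) * FreeGroup.of (some i) *
              (FreeGroup.of (some j) * FreeGroup.of (some i) * FreeGroup.of (some j))⁻¹) ∨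
        (∃ i j : Fin m, (i : ℕ) + 1 < (j : ℕ) ∧
          r = FreeGroup.of (some i) * FreeGroup.of (some j) *
              (FreeGroup.of (some j) * FreeGroup.of (some i))⁻¹) }

/-- The mixed braid group `B_{1,n}` with `n = m+1` moving strands. -/
abbrev B (m : ℕ) := PresentedGroup (rels m)

/-- The braiding generator `σ_{i+1}`, for `i : Fin m`. -/
def σ {m : ℕ} (i : Fin m) : B m := PresentedGroup.of (some i)

/-- The looping generator `t`. -/
def τ {m : ℕ} : B m := PresentedGroup.of none

/-- `σ_j` in one-based indexing (`1 ≤ j ≤ m`), junk value `1` out of range. -/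
def sig {m : ℕ} (j : ℕ) : B m :=
  if h : 1 ≤ j ∧ j - 1 < m then σ ⟨j - 1, h.2⟩ else 1

/-- The looping elements `t_i = σ_i ⋯ σ_1 t σ_1 ⋯ σ_i` (for `0 ≤ i ≤ m`), via `t_0 = t`,
`t_{j+1} = σ_{j+1} t_j σ_{j+1}`. -/
def tt {m : ℕ} : ℕ → B m
  | 0 => τ
  | (j+1) => sig (j+1) * tt j * sig (j+1)

/-- The looping elements `t′_i = σ_i ⋯ σ_1 t σ_1⁻¹ ⋯ σ_i⁻¹` (for `0 ≤ i ≤ m`), via `t′_0 = t`,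
`t′_{j+1} = σ_{j+1} t′_j σ_{j+1}⁻¹`. -/
def tp {m : ℕ} : ℕ → B m
  | 0 => τ
  | (j+1) => sig (j+1) * tp j * (sig (j+1))⁻¹

/-! ## The generalized Iwahori–Hecke algebra of type B, `H_{1,n}(q)` -/

/-- The ground ring `R = ℂ[q^{±1}]` of Laurent polynomials. -/
abbrev R : Type := LaurentPolynomial ℂ

instance : IsDomain R := NoZeroDivisors.to_isDomain _

/-- The variable `q ∈ R`. -/
noncomputable def qq : R := LaurentPolynomial.T 1

/-- The quadratic Hecke relations `σ_i² = (q-1)σ_i + q`. -/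
inductive heckeRel (m : ℕ) :
    MonoidAlgebra R (B m) → MonoidAlgebra R (B m) → Prop
  | quad (i : Fin m) : heckeRel m
      (MonoidAlgebra.of R (B m) (σ i) * MonoidAlgebra.of R (B m) (σ i))
      ((qq - 1) • MonoidAlgebra.of R (B m) (σ i) + qq • (1 : MonoidAlgebra R (B m)))

/-- The generalized Iwahori–Hecke algebra of type B, `H_{1,n}(q)` (`n = m+1`), as the quotient
of the group algebra `R[B_{1,n}]` by the two-sided ideal generated by the quadratic relations. -/
abbrev H (m : ℕ) := RingQuot (heckeRel m)

/-- The canonical multiplicative map `π : B_{1,n} → H_{1,n}(q)`. -/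
noncomputable def pih (m : ℕ) : B m →* H m :=
  (RingQuot.mkRingHom (heckeRel m)).toMonoidHom.comp (MonoidAlgebra.of R (B m))

/-- The subalgebra `H_n(q)` of `H_{1,n}(q)` generated by the images `g_1, …, g_{n-1}`
of `σ_1, …, σ_{n-1}`. -/
noncomputable def HA (m : ℕ) : Subalgebra R (H m) :=
  Algebra.adjoin R (Set.range fun i : Fin m => pih m (σ i))

/-! ## Helper lemmas: group level -/

theorem sig_eq {m : ℕ} (i : Fin m) : (sig ((i : ℕ) + 1) : B m) = σ i := by
  unfold sig
  rw [dif_pos ⟨by omega, by simp⟩]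
  rfl

theorem sig_junk {m : ℕ} {j : ℕ} (h : ¬ (1 ≤ j ∧ j - 1 < m)) : (sig j : B m) = 1 := by
  unfold sig
  rw [dif_neg h]

theorem rel_one {m : ℕ} {a b : FreeGroup (MBGen m)} (h : a * b⁻¹ ∈ rels m) :
    PresentedGroup.mk (rels m) a = PresentedGroup.mk (rels m) b := by
  have h1 := PresentedGroup.one_of_mem h
  rw [map_mul, map_inv, mul_inv_eq_one] at h1
  exact h1

theorem tau_sig_one {m : ℕ} : (sig 1 * τ : B m) ^ 2 = (τ * sig 1) ^ 2 := by
  by_cases h : 0 < m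
  · have h1 : (sig 1 : B m) = σ ⟨0, h⟩ := sig_eq (⟨0, h⟩ : Fin m)
    rw [h1]
    exact rel_one (Or.inl ⟨h, rfl⟩)
  · rw [sig_junk (by omega)]
    simp

theorem tau_comm {m : ℕ} (j : ℕ) (hj : 2 ≤ j) : Commute (τ : B m) (sig j) := by
  by_cases h : 1 ≤ j ∧ j - 1 < m
  · obtain ⟨i, rfl⟩ : ∃ i, j = i + 1 := ⟨j - 1, by omega⟩
    have h1 : (sig (i + 1) : B m) = σ ⟨i, by omega⟩ := sig_eq (⟨i, by omega⟩ : Fin m)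
    rw [h1]
    exact rel_one (Or.inr (Or.inl ⟨⟨i, by omega⟩, by simp; omega, rfl⟩))
  · rw [sig_junk h]
    exact Commute.one_right _

theorem sig_braid {m : ℕ} (j : ℕ) (hj : 1 ≤ j) (hm : j + 1 ≤ m) :
    (sig j * sig (j + 1) * sig j : B m) = sig (j + 1) * sig j * sig (j + 1) := by
  obtain ⟨i, rfl⟩ : ∃ i, j = i + 1 := ⟨j - 1, by omega⟩
  have h1 : (sig (i + 1) : B m) = σ ⟨i, by omega⟩ := sig_eq (⟨i, by omega⟩ : Fin m)
  have h2 : (sig (i + 1 + 1) : B m) = σ ⟨i + 1, by omega⟩ := sig_eq (⟨i + 1, by omega⟩ : Fin m)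
  rw [h1, h2]
  exact rel_one (Or.inr (Or.inr (Or.inl ⟨⟨i, by omega⟩, ⟨i + 1, by omega⟩, rfl, rfl⟩)))

theorem sig_comm {m : ℕ} (i j : ℕ) (hij : i + 1 < j) : Commute (sig i : B m) (sig j) := by
  by_cases hi : 1 ≤ i ∧ i - 1 < m
  swap
  · rw [sig_junk hi]
    exact Commute.one_left _
  by_cases hj : 1 ≤ j ∧ j - 1 < m
  swap
  · rw [sig_junk hj]
    exact Commute.one_right _
  obtain ⟨a, rfl⟩ : ∃ a, i = a + 1 := ⟨i - 1, by omega⟩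
  obtain ⟨b, rfl⟩ : ∃ b, j = b + 1 := ⟨j - 1, by omega⟩
  have h1 : (sig (a + 1) : B m) = σ ⟨a, by omega⟩ := sig_eq (⟨a, by omega⟩ : Fin m)
  have h2 : (sig (b + 1) : B m) = σ ⟨b, by omega⟩ := sig_eq (⟨b, by omega⟩ : Fin m)
  rw [h1, h2]
  exact rel_one (Or.inr (Or.inr (Or.inr
    ⟨⟨a, by omega⟩, ⟨b, by omega⟩, by simp only; omega, rfl⟩)))

theorem tt_comm_high {m : ℕ} (i j : ℕ) (hij : i + 1 < j) : Commute (tt i : B m) (sig j) := by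
  induction i with
  | zero => exact tau_comm j (by omega)
  | succ i ih =>
    have h1 := sig_comm (m := m) (i + 1) j (by omega)
    exact (h1.mul_left (ih (by omega))).mul_left h1

theorem tt_comm_low {m : ℕ} (i : ℕ) (hi : i ≤ m) :
    ∀ j, 1 ≤ j → j < i → Commute (tt i : B m) (sig j) := by
  induction i with
  | zero => intro j h1 h2; omega
  | succ i ih =>
    intro j h1 h2
    by_cases hji : j < i
    · have h3 := (sig_comm (m := m) j (i + 1) (by omega)).symm
      exact (h3.mul_left (ih (by omega) j h1 hji)).mul_left h3
    · obtain rfl : j = i := by omega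
      obtain ⟨a, rfl⟩ : ∃ a, j = a + 1 := ⟨j - 1, by omega⟩
      have hb := sig_braid (m := m) (a + 1) (by omega) (by omega)
      have hc : (tt a * sig (a + 1 + 1) : B m) = sig (a + 1 + 1) * tt a :=
        tt_comm_high a (a + 1 + 1) (by omega)
      change (sig (a + 1 + 1) * (sig (a + 1) * tt a * sig (a + 1)) * sig (a + 1 + 1)) * sig (a + 1)
        = sig (a + 1) * (sig (a + 1 + 1) * (sig (a + 1) * tt a * sig (a + 1)) * sig (a + 1 + 1))
      generalize (sig (a + 1 + 1) : B m) = y at *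
      generalize (sig (a + 1) : B m) = x at *
      generalize (tt a : B m) = z at *
      calc y * (x * z * x) * y * x = y * x * z * (x * y * x) := by group
        _ = y * x * (z * y) * x * y := by rw [hb]; group
        _ = (y * x * y) * z * x * y := by rw [hc]; group
        _ = x * (y * (x * z * x) * y) := by rw [← hb]; group

theorem tt_comm_tau {m : ℕ} (i : ℕ) : Commute (tt i : B m) τ := by
  induction i with
  | zero => exact Commute.refl _
  | succ i ih =>
    rcases Nat.eq_zero_or_pos i with rfl | h
    · have h1 := tau_sig_one (m := m)
      change sig 1 * τ * sig 1 * τ = τ * (sig 1 * τ * sig 1)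
      rw [pow_two, pow_two] at h1
      simpa [mul_assoc] using h1
    · have h3 := (tau_comm (m := m) (i + 1) (by omega)).symm
      exact (h3.mul_left ih).mul_left h3

theorem tt_comm_lt {m : ℕ} (j : ℕ) (hj : j ≤ m) (i : ℕ) (hij : i < j) :
    Commute (tt j : B m) (tt i) := by
  induction i with
  | zero => exact tt_comm_tau j
  | succ i ih =>
    have h3 := tt_comm_low (m := m) j hj (i + 1) (by omega) hij
    exact (h3.mul_right (ih (by omega))).mul_right h3

theorem tt_comm {m : ℕ} (i j : ℕ) (hi : i ≤ m) (hj : j ≤ m) :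
    Commute (tt i : B m) (tt j) := by
  rcases lt_trichotomy i j with h | rfl | h
  · exact (tt_comm_lt j hj i h).symm
  · exact Commute.refl _
  · exact tt_comm_lt i hi j h

/-! ## Monomials in commuting elements -/

theorem mono_mul {G : Type*} [Group G] {n : ℕ} (c : Fin n → G)
    (hc : ∀ i j, Commute (c i) (c j)) (a b : Fin n → ℤ) :
    (List.ofFn fun j => c j ^ a j).prod * (List.ofFn fun j => c j ^ b j).prod =
      (List.ofFn fun j => c j ^ (a j + b j)).prod := by
  induction n with
  | zero => simp
  | succ n ih =>
    rw [List.ofFn_succ, List.ofFn_succ, List.ofFn_succ, List.prod_cons, List.prod_cons,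
      List.prod_cons, ← ih (fun j => c j.succ) (fun i j => hc _ _)]
    have h : Commute (c 0 ^ b 0) (List.ofFn fun j : Fin n => c j.succ ^ a j.succ).prod := by
      apply Commute.list_prod_right
      intro x hx
      rw [List.mem_ofFn] at hx
      obtain ⟨j, rfl⟩ := hx
      exact (hc _ _).zpow_zpow _ _
    rw [zpow_add, mul_assoc, mul_assoc, ← mul_assoc _ (c 0 ^ b 0), ← h.eq, mul_assoc]

theorem mono_single {G : Type*} [Group G] {n : ℕ} (c : Fin n → G) (i : Fin n) (e : ℤ) :
    (List.ofFn fun j => c j ^ (Pi.single i e : Fin n → ℤ) j).prod = c i ^ e := by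
  induction n with
  | zero => exact i.elim0
  | succ n ih =>
    rw [List.ofFn_succ, List.prod_cons]
    refine Fin.cases ?_ (fun i => ?_) i
    · have : (List.ofFn fun j : Fin n => c j.succ ^ (Pi.single 0 e : Fin (n + 1) → ℤ) j.succ).prod
          = 1 := by
        apply List.prod_eq_one
        intro x hx
        rw [List.mem_ofFn] at hx
        obtain ⟨j, rfl⟩ := hx
        simp
      rw [this]
      simp
    · have h2 : (fun j : Fin n => c j.succ ^ (Pi.single i.succ e : Fin (n + 1) → ℤ) j.succ) =
          fun j : Fin n => c j.succ ^ (Pi.single i e : Fin n → ℤ) j := by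
        funext j
        congr 1
        by_cases h : j = i
        · subst h; simp
        · rw [Pi.single_eq_of_ne h, Pi.single_eq_of_ne (by simpa using h)]
      rw [h2, ih (fun j => c j.succ) i]
      simp

/-! ## The Hecke algebra -/

theorem pih_quad {m : ℕ} (i : Fin m) :
    pih m (σ i) * pih m (σ i) = (qq - 1) • pih m (σ i) + qq • (1 : H m) := by
  have h := RingQuot.mkAlgHom_rel R (heckeRel.quad (m := m) i)
  rw [map_mul, map_add, map_smul, map_smul, map_one] at h
  have e : ∀ x, RingQuot.mkAlgHom R (heckeRel m) x = RingQuot.mkRingHom (heckeRel m) x := by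
    intro x
    rw [← RingQuot.mkAlgHom_coe R]
    rfl
  rw [e] at h
  exact h

theorem qq_inv : (LaurentPolynomial.T (-1) : R) * qq = 1 := by
  unfold qq
  rw [← LaurentPolynomial.T_add]
  simp

theorem pih_inv_mul {m : ℕ} (x : B m) : pih m x⁻¹ * pih m x = 1 := by
  rw [← map_mul]; simp

theorem pih_mul_inv {m : ℕ} (x : B m) : pih m x * pih m x⁻¹ = 1 := by
  rw [← map_mul]; simp

theorem sig_mem {m : ℕ} (i : Fin m) : pih m (σ i) ∈ HA m :=
  Algebra.subset_adjoin ⟨i, rfl⟩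

theorem pih_inv_eq {m : ℕ} (i : Fin m) :
    pih m (σ i)⁻¹ = (LaurentPolynomial.T (-1) : R) • (pih m (σ i) + (-(qq - 1)) • (1 : H m)) := by
  have h := pih_quad i
  have h2 : pih m (σ i) = (qq - 1) • (1 : H m) + qq • pih m (σ i)⁻¹ := by
    have h3 := congrArg (fun z => z * pih m (σ i)⁻¹) h
    simpa [mul_assoc, add_mul, pih_mul_inv] using h3
  have h4 : pih m (σ i) + (-(qq - 1)) • (1 : H m) = qq • pih m (σ i)⁻¹ := by
    calc pih m (σ i) + (-(qq - 1)) • (1 : H m)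
        = ((qq - 1) • (1 : H m) + qq • pih m (σ i)⁻¹) + (-(qq - 1)) • (1 : H m) := by rw [← h2]
      _ = qq • pih m (σ i)⁻¹ := by
        rw [add_right_comm, ← add_smul, add_neg_cancel, zero_smul, zero_add]
  rw [h4, smul_smul, qq_inv, one_smul]

theorem sig_inv_mem {m : ℕ} (i : Fin m) : pih m (σ i)⁻¹ ∈ HA m := by
  rw [pih_inv_eq]
  exact Subalgebra.smul_mem _ (Subalgebra.add_mem _ (sig_mem i)
    (Subalgebra.smul_mem _ (Subalgebra.one_mem _) _)) _

/-- `H_n(q)` as a submodule. -/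
noncomputable def SS (m : ℕ) : Submodule R (H m) := Subalgebra.toSubmodule (HA m)

/-- Span of the `t_j ^ e`. -/
noncomputable def PP (m : ℕ) (e : ℤ) : Submodule R (H m) :=
  Submodule.span R (Set.range fun j : Fin (m + 1) => pih m (tt (j : ℕ) ^ e))

theorem mem_PP {m : ℕ} (e : ℤ) (j : ℕ) (hj : j ≤ m) : pih m (tt j ^ e) ∈ PP m e :=
  Submodule.subset_span ⟨⟨j, by omega⟩, rfl⟩

theorem PS_intro {m : ℕ} (e : ℤ) (j : ℕ) (hj : j ≤ m) (u : H m) (hu : u ∈ HA m) :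
    pih m (tt j ^ e) * u ∈ PP m e * SS m :=
  Submodule.mul_mem_mul (mem_PP e j hj) hu

/-- If `y = g x g` then `g x = y g⁻¹` and `g y = (q-1) y + q x g`. -/
theorem two_moves {m : ℕ} (i : Fin m) (x y : B m) (h : y = σ i * x * σ i) :
    pih m (σ i) * pih m x = pih m y * pih m (σ i)⁻¹ ∧
    pih m (σ i) * pih m y = (qq - 1) • (pih m y * 1) + qq • (pih m x * pih m (σ i)) := by
  constructor
  · rw [← map_mul, ← map_mul, h]
    congr 1
    group
  · have hy : pih m y = pih m (σ i) * pih m x * pih m (σ i) := by rw [h, map_mul, map_mul]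
    rw [hy, ← mul_assoc, ← mul_assoc, pih_quad]
    simp [add_mul, mul_assoc]

theorem sig_PP {m : ℕ} (e : ℤ) (he : e = 1 ∨ e = -1) (i : Fin m) (j : ℕ) (hj : j ≤ m) :
    pih m (σ i) * pih m (tt j ^ e) ∈ PP m e * SS m := by
  have hi := i.2
  have hdef : (tt ((i : ℕ) + 1) : B m) = σ i * tt (i : ℕ) * σ i := by
    rw [← sig_eq i]; rfl
  have key : ∀ a b : ℕ, a ≤ m → b ≤ m → (tt b ^ e : B m) = σ i * tt a ^ e * σ i →
      (pih m (σ i) * pih m (tt a ^ e) ∈ PP m e * SS m ∧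
        pih m (σ i) * pih m (tt b ^ e) ∈ PP m e * SS m) := by
    intro a b ha hb h
    obtain ⟨h1, h2⟩ := two_moves i _ _ h
    rw [h1, h2]
    exact ⟨PS_intro e b hb _ (sig_inv_mem i), Submodule.add_mem _
      (Submodule.smul_mem _ _ (PS_intro e b hb _ (Subalgebra.one_mem _)))
      (Submodule.smul_mem _ _ (PS_intro e a ha _ (sig_mem i)))⟩
  have key2 : pih m (σ i) * pih m (tt (i : ℕ) ^ e) ∈ PP m e * SS m ∧
      pih m (σ i) * pih m (tt ((i : ℕ) + 1) ^ e) ∈ PP m e * SS m := by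
    rcases he with rfl | rfl
    · exact key _ _ (by omega) (by omega) (by rw [zpow_one, zpow_one]; exact hdef)
    · exact (key _ _ (by omega) (by omega) (by rw [zpow_neg_one, zpow_neg_one, hdef]; group)).symm
  by_cases h1 : j = i
  · rw [h1]; exact key2.1
  by_cases h2 : j = i + 1
  · rw [h2]; exact key2.2
  have hc : Commute (tt j : B m) (sig ((i : ℕ) + 1)) := by
    by_cases h3 : j < i
    · exact tt_comm_high j _ (by omega)
    · exact tt_comm_low j hj _ (by omega) (by omega)
  rw [sig_eq i] at hc
  have hc2 := hc.zpow_left e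
  rw [← map_mul, ← hc2.eq, map_mul]
  exact PS_intro e j hj _ (sig_mem i)

theorem SS_mul_SS (m : ℕ) : SS m * SS m = SS m := (HA m).isIdempotentElem_toSubmodule

theorem SP_le {m : ℕ} (e : ℤ) (he : e = 1 ∨ e = -1) : SS m * PP m e ≤ PP m e * SS m := by
  rw [Submodule.mul_le]
  intro s hs p hp
  change s ∈ Algebra.adjoin R _ at hs
  induction hs using Algebra.adjoin_induction generalizing p with
  | mem x hx =>
    obtain ⟨i, rfl⟩ := hx
    unfold PP at hp
    induction hp using Submodule.span_induction with
    | mem y hy =>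
      obtain ⟨j, rfl⟩ := hy
      exact sig_PP e he i j (by omega)
    | zero => rw [mul_zero]; exact Submodule.zero_mem _
    | add a b _ _ ha hb => rw [mul_add]; exact Submodule.add_mem _ ha hb
    | smul r a _ ha => rw [mul_smul_comm]; exact Submodule.smul_mem _ _ ha
  | algebraMap r =>
    rw [← Algebra.smul_def, ← mul_one (r • p)]
    exact Submodule.mul_mem_mul (Submodule.smul_mem _ _ hp) (Subalgebra.one_mem (HA m))
  | add a b _ _ ha hb => rw [add_mul]; exact Submodule.add_mem _ (ha p hp) (hb p hp)
  | mul a b _ _ ha hb =>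
    have h1 := hb p hp
    have h2 : ∀ z ∈ PP m e * SS m, a * z ∈ PP m e * SS m := by
      intro z hz
      induction hz using Submodule.mul_induction_on' with
      | mem_mul_mem x hx y hy =>
        rw [← mul_assoc]
        have := Submodule.mul_mem_mul (ha x hx) hy
        rwa [mul_assoc, SS_mul_SS] at this
      | add x _ y _ hx hy => rw [mul_add]; exact Submodule.add_mem _ hx hy
    rw [mul_assoc]
    exact h2 _ h1

theorem tp_mem {m : ℕ} (e : ℤ) (he : e = 1 ∨ e = -1) (j : ℕ) (hj : j ≤ m) :
    pih m (tp j ^ e) ∈ PP m e * SS m := by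
  induction j with
  | zero =>
    have := PS_intro (m := m) e 0 hj 1 (Subalgebra.one_mem _)
    rwa [mul_one] at this
  | succ j ih =>
    have h1 : (tp (j + 1) ^ e : B m) = σ ⟨j, by omega⟩ * tp j ^ e * (σ ⟨j, by omega⟩)⁻¹ := by
      rw [← conj_zpow, ← sig_eq]; rfl
    rw [h1, map_mul, map_mul]
    have h2 := Submodule.mul_mem_mul (Submodule.mul_mem_mul (M := SS m)
      (sig_mem (⟨j, by omega⟩ : Fin m)) (ih (by omega))) (N := SS m)
      (sig_inv_mem (⟨j, by omega⟩ : Fin m))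
    have h3 : SS m * (PP m e * SS m) * SS m ≤ PP m e * SS m := by
      calc SS m * (PP m e * SS m) * SS m = (SS m * PP m e) * (SS m * SS m) := by
            simp only [mul_assoc]
        _ ≤ (PP m e * SS m) * (SS m * SS m) := mul_le_mul' (SP_le e he) le_rfl
        _ = PP m e * SS m := by rw [SS_mul_SS, mul_assoc, SS_mul_SS]
    exact h3 h2

theorem PS_pow {m : ℕ} (e : ℤ) (he : e = 1 ∨ e = -1) (n : ℕ) :
    (PP m e * SS m) ^ n * SS m ≤ PP m e ^ n * SS m := by
  induction n with
  | zero => simp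
  | succ n ih =>
    calc (PP m e * SS m) ^ (n + 1) * SS m
        = PP m e * (SS m * ((PP m e * SS m) ^ n * SS m)) := by rw [pow_succ']; simp only [mul_assoc]
      _ ≤ PP m e * (SS m * (PP m e ^ n * SS m)) := mul_le_mul' le_rfl (mul_le_mul' le_rfl ih)
      _ ≤ PP m e * (PP m e ^ n * SS m) := by
          refine mul_le_mul' le_rfl ?_
          have h : ∀ k : ℕ, SS m * PP m e ^ k ≤ PP m e ^ k * SS m := by
            intro k
            induction k with
            | zero => simp
            | succ k ihk =>
              calc SS m * PP m e ^ (k + 1) = (SS m * PP m e ^ k) * PP m e := by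
                    rw [pow_succ, mul_assoc]
                _ ≤ (PP m e ^ k * SS m) * PP m e := mul_le_mul' ihk le_rfl
                _ = PP m e ^ k * (SS m * PP m e) := by rw [mul_assoc]
                _ ≤ PP m e ^ k * (PP m e * SS m) := mul_le_mul' le_rfl (SP_le e he)
                _ = PP m e ^ (k + 1) * SS m := by rw [pow_succ, mul_assoc]
          calc SS m * (PP m e ^ n * SS m) = (SS m * PP m e ^ n) * SS m := by rw [mul_assoc]
            _ ≤ (PP m e ^ n * SS m) * SS m := mul_le_mul' (h n) le_rfl
            _ = PP m e ^ n * SS m := by rw [mul_assoc, SS_mul_SS]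
      _ = PP m e ^ (n + 1) * SS m := by rw [pow_succ', mul_assoc]

/-- Monomials `t^{λ_0} ⋯ t_m^{λ_m}`. -/
def mono {m : ℕ} (a : Fin (m + 1) → ℤ) : B m :=
  (List.ofFn fun j : Fin (m + 1) => tt (j : ℕ) ^ a j).prod

/-- The exponent condition. -/
def good {m : ℕ} (e : ℤ) (n : ℕ) (a : Fin (m + 1) → ℤ) : Prop :=
  (∑ j, a j = n * e) ∧ ∀ j, 0 ≤ e * a j

theorem PP_pow {m : ℕ} (e : ℤ) (n : ℕ) :
    PP m e ^ n ≤ Submodule.span R {y | ∃ a, good (m := m) e n a ∧ y = pih m (mono a)} := by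
  induction n with
  | zero =>
    rw [pow_zero, Submodule.one_le]
    apply Submodule.subset_span
    refine ⟨fun _ => 0, ⟨by simp, by simp⟩, ?_⟩
    have : mono (m := m) (fun _ => 0) = 1 := by
      apply List.prod_eq_one
      intro x hx
      rw [List.mem_ofFn] at hx
      obtain ⟨j, rfl⟩ := hx
      simp
    rw [this, map_one]
  | succ n ih =>
    rw [pow_succ]
    refine (mul_le_mul' ih le_rfl).trans ?_
    unfold PP
    rw [Submodule.span_mul_span]
    apply Submodule.span_mono
    rintro _ ⟨_, ⟨a, ha, rfl⟩, _, ⟨j, rfl⟩, rfl⟩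
    refine ⟨fun i => a i + (Pi.single j e : Fin (m + 1) → ℤ) i, ⟨?_, ?_⟩, ?_⟩
    · rw [Finset.sum_add_distrib, ha.1, Finset.sum_pi_single']
      simp
      ring
    · intro i
      have h1 := ha.2 i
      change 0 ≤ e * (a i + (Pi.single j e : Fin (m + 1) → ℤ) i)
      by_cases h : i = j
      · subst h
        rw [Pi.single_eq_same]
        nlinarith [mul_self_nonneg e]
      · rw [Pi.single_eq_of_ne h, add_zero]
        exact h1
    · change pih m (mono a) * pih m (tt (j : ℕ) ^ e) = _
      rw [← map_mul]
      congr 1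
      unfold mono
      rw [← mono_mul (fun j : Fin (m + 1) => (tt (j : ℕ) : B m))
        (fun i j => tt_comm _ _ (by omega) (by omega)),
        mono_single (fun j : Fin (m + 1) => (tt (j : ℕ) : B m))]

theorem tp_pow_mem {m : ℕ} (e : ℤ) (he : e = 1 ∨ e = -1) (n : ℕ) :
    pih m (tp m ^ (n * e)) ∈ Submodule.span R
      {y | ∃ a u, good (m := m) e n a ∧ u ∈ HA m ∧ y = pih m (mono a) * u} := by
  have h1 : pih m (tp m ^ (n * e)) ∈ PP m e ^ n * SS m := by
    have h2 : pih m (tp m ^ (n * e)) = pih m (tp m ^ e) ^ n * 1 := by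
      rw [mul_one, ← map_pow, mul_comm, zpow_mul, zpow_natCast]
    rw [h2]
    exact PS_pow e he n (Submodule.mul_mem_mul (Submodule.pow_mem_pow _ (tp_mem e he m le_rfl) n)
      (Subalgebra.one_mem (HA m)))
  have h3 := mul_le_mul' (PP_pow (m := m) e n) (le_refl (SS m)) h1
  rw [← Submodule.span_eq (SS m), Submodule.span_mul_span] at h3
  refine Submodule.span_mono ?_ h3
  rintro _ ⟨_, ⟨a, ha, rfl⟩, u, hu, rfl⟩
  exact ⟨a, u, ha, hu, rfl⟩

theorem tt_pow_mem {m : ℕ} (e : ℤ) (n : ℕ) :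
    pih m (tt m ^ (n * e)) ∈ Submodule.span R
      {y | ∃ a u, good (m := m) e n a ∧ u ∈ HA m ∧ y = pih m (mono a) * u} := by
  apply Submodule.subset_span
  refine ⟨Pi.single (Fin.last m) (n * e), 1, ⟨by simp, fun j => ?_⟩, Subalgebra.one_mem _, ?_⟩
  · by_cases h : j = Fin.last m
    · subst h
      rw [Pi.single_eq_same]
      nlinarith [mul_nonneg (Int.natCast_nonneg n) (mul_self_nonneg e)]
    · rw [Pi.single_eq_of_ne h]; simp
  · unfold mono
    rw [mono_single (fun j : Fin (m + 1) => (tt (j : ℕ) : B m)), mul_one]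
    rfl

/-- For `m ≥ 1` and `k ∈ ℤ∖{0}`, in `H_{1,m+1}(q)`:
`(t′_m)^k = q^{−mk}·t_m^k + Σ_i f_i·t_m^k·w_i + Σ_i g_i·t^{λ_0}t_1^{λ_1}⋯t_m^{λ_m}·u_i`,
with `w_i, u_i ∈ H_{m+1}(q)`, `Σ_j λ_j = k`, and all `λ_j ≥ 0` if `k > 0`
(resp. all `λ_j ≤ 0` if `k < 0`). -/
theorem tp_power_expansion (m : ℕ) (hm : 1 ≤ m) (k : ℤ) (hk : k ≠ 0) :
    ∃ (N : ℕ) (f g : Fin N → R) (w u : Fin N → H m) (lam : Fin N → Fin (m+1) → ℤ),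
      (∀ i, w i ∈ HA m) ∧ (∀ i, u i ∈ HA m) ∧
      (∀ i, ∑ j, lam i j = k) ∧
      (0 < k → ∀ i j, 0 ≤ lam i j) ∧ (k < 0 → ∀ i j, lam i j ≤ 0) ∧
      pih m (tp m ^ k) =
        (LaurentPolynomial.T (-(m * k)) : R) • pih m (tt m ^ k) +
          (∑ i, f i • (pih m (tt m ^ k) * w i)) +
          ∑ i, g i •
            (pih m ((List.ofFn fun j : Fin (m+1) => tt (j : ℕ) ^ lam i j).prod) * u i) := by
  obtain ⟨e, n, he, rfl⟩ : ∃ (e : ℤ) (n : ℕ), (e = 1 ∨ e = -1) ∧ k = n * e := by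
    rcases le_total 0 k with h | h
    · exact ⟨1, k.toNat, Or.inl rfl, by omega⟩
    · exact ⟨-1, (-k).toNat, Or.inr rfl, by omega⟩
  have h := Submodule.add_mem _ (tp_pow_mem (m := m) e he n)
    (Submodule.smul_mem _ (-(LaurentPolynomial.T (-(m * (n * e))) : R)) (tt_pow_mem (m := m) e n))
  rw [Submodule.mem_span_set'] at h
  obtain ⟨N, c, y, hy⟩ := h
  choose a u ha hu hyu using fun i => (y i).2
  refine ⟨N, fun _ => 0, c, fun _ => 0, u, a, fun _ => Subalgebra.zero_mem _, hu,
    fun i => (ha i).1, ?_, ?_, ?_⟩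
  · intro hk i j
    have := (ha i).2 j
    rcases he with rfl | rfl <;> omega
  · intro hk i j
    have := (ha i).2 j
    rcases he with rfl | rfl <;> omega
  · have h2 : ∑ i, c i • (pih m (mono (a i)) * u i) = ∑ i, c i • (y i : H m) :=
      Finset.sum_congr rfl fun i _ => by rw [hyu i]
    change _ = _ + _ + ∑ i, c i • (pih m (mono (a i)) * u i)
    rw [h2, hy]
    simp only [zero_smul, Finset.sum_const_zero, add_zero]
    rw [add_left_comm, ← add_smul, add_neg_cancel, zero_smul, add_zero]

end MB
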